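/- Let d be a positive integer. There exists a constant C > 0, depending only on q and d, such that for every non-negative integer D, every s ∈ ℂ with σ = Re(s) > d+2, and every i ∈ {1,2,3}: |F_q^{(i)}(D;s;d)| ≤ C · Σ_{t>D} q^{(σ−d−2)t}(log 2t)^{d+1}/[t]_q^{σ−d−1}. -/

import Mathlib

open Complex

/-- The `q`-analogue `[n]_q = (1 - q^n)/(1 - q)` of a natural number `n`. -/
noncomputable def qnum (q : ℝ) (n : ℕ) : ℝ := (1 - q ^ n) / (1 - q)

/-- The product `∏_i q^{n_i}/[n_i]_q` over a chain `n₁ ≤ ⋯ ≤ n_d`. -/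
noncomputable def chainProd (q : ℝ) {d : ℕ} (n : Fin d → ℕ) : ℂ :=
  ∏ i, ((q : ℂ) ^ (n i) / (qnum q (n i) : ℂ))

/-- The index set for `F_q^{(0)}(D;s;d)`: pairs of `m > D` and chains
`m − D ≤ n₁ ≤ ⋯ ≤ n_d ≤ m`. -/
def F0Idx (D d : ℕ) : Type :=
  {p : ℕ × (Fin d → ℕ) // D < p.1 ∧ Monotone p.2 ∧ ∀ i, p.1 - D ≤ p.2 i ∧ p.2 i ≤ p.1}

/-- The general term of the series `F_q^{(0)}(D;s;d)`. -/
noncomputable def F0term (q : ℝ) (d : ℕ) (s : ℂ) (p : ℕ × (Fin d → ℕ)) : ℂ :=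
  ((q : ℂ) ^ ((s - (d : ℂ) - 1) * (p.1 : ℂ)) / (qnum q p.1 : ℂ) ^ (s - (d : ℂ))) *
    chainProd q p.2

/-- The index set for `F_q^{(1)}, F_q^{(2)}, F_q^{(3)}`: triples of `D < t < m` and chains
`m − t ≤ n₁ ≤ ⋯ ≤ n_d ≤ m`. -/
def FIdx (D d : ℕ) : Type :=
  {p : ℕ × ℕ × (Fin d → ℕ) // D < p.1 ∧ p.1 < p.2.1 ∧ Monotone p.2.2 ∧
    ∀ i, p.2.1 - p.1 ≤ p.2.2 i ∧ p.2.2 i ≤ p.2.1}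

/-- The general term of the series `F_q^{(1)}(D;s;d)`. -/
noncomputable def F1term (q : ℝ) (d : ℕ) (s : ℂ) (p : ℕ × ℕ × (Fin d → ℕ)) : ℂ :=
  ((q : ℂ) ^ ((s - (d : ℂ) - 2) * (p.1 : ℂ)) * (q : ℂ) ^ (p.2.1 - p.1) /
      ((qnum q p.1 : ℂ) ^ (s - (d : ℂ) - 1) * (qnum q (p.2.1 - p.1) : ℂ))) *
    chainProd q p.2.2

/-- The general term of the series `F_q^{(2)}(D;s;d)`. -/
noncomputable def F2term (q : ℝ) (d : ℕ) (s : ℂ) (p : ℕ × ℕ × (Fin d → ℕ)) : ℂ :=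
  ((q : ℂ) ^ ((s - (d : ℂ) - 2) * (p.2.1 : ℂ)) * (q : ℂ) ^ (p.2.1) /
      ((qnum q p.1 : ℂ) ^ (s - (d : ℂ) - 1) * (qnum q p.2.1 : ℂ))) *
    chainProd q p.2.2

/-- The general term of the series `F_q^{(3)}(D;s;d)`. -/
noncomputable def F3term (q : ℝ) (d : ℕ) (s : ℂ) (p : ℕ × ℕ × (Fin d → ℕ)) : ℂ :=
  ((q : ℂ) ^ ((s - (d : ℂ) - 2) * (p.2.1 : ℂ)) * (q : ℂ) ^ (p.2.1 - p.1) /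
      ((qnum q p.2.1 : ℂ) ^ (s - (d : ℂ) - 1) * (qnum q (p.2.1 - p.1) : ℂ))) *
    chainProd q p.2.2

open Finset in
theorem summable_pi_prod {ι α : Type*} [Fintype ι] {f : α → ℝ} (hf : Summable f)
    (h0 : ∀ a, 0 ≤ f a) : Summable fun n : ι → α => ∏ i, f (n i) := by
  classical
  refine summable_of_sum_le (c := ∏ _i : ι, ∑' a, f a)
    (fun n => prod_nonneg fun i _ => h0 _) fun u => ?_
  calc ∑ n ∈ u, ∏ i, f (n i)
      ≤ ∑ n ∈ Fintype.piFinset fun i => u.image fun n => n i, ∏ i, f (n i) := by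
        refine sum_le_sum_of_subset_of_nonneg (fun n hn => ?_)
          fun n _ _ => prod_nonneg fun i _ => h0 _
        exact Fintype.mem_piFinset.2 fun i => mem_image_of_mem (fun n => n i) hn
    _ = ∏ i, ∑ a ∈ u.image fun n => n i, f a := (prod_univ_sum _ _).symm
    _ ≤ ∏ _i : ι, ∑' a, f a :=
        prod_le_prod (fun i _ => sum_nonneg fun a _ => h0 a)
          fun i _ => hf.sum_le_tsum _ fun a _ => h0 a

theorem one_le_qnum {q : ℝ} (hq0 : 0 < q) (hq1 : q < 1) {n : ℕ} (hn : 1 ≤ n) :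
    1 ≤ qnum q n := by
  have h : q ^ n ≤ q ^ 1 := pow_le_pow_of_le_one hq0.le hq1.le hn
  rw [qnum, le_div_iff₀ (by linarith)]
  linarith [pow_one q]

theorem qnum_mono {q : ℝ} (hq0 : 0 < q) (hq1 : q < 1) : Monotone (qnum q) := by
  intro m n hmn
  have h : q ^ n ≤ q ^ m := pow_le_pow_of_le_one hq0.le hq1.le hmn
  exact div_le_div_of_nonneg_right (by linarith) (by linarith)

theorem norm_chainProd_le {q : ℝ} (hq0 : 0 < q) (hq1 : q < 1) {d : ℕ} {n : Fin d → ℕ}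
    (hn : ∀ i, 1 ≤ n i) : ‖chainProd q n‖ ≤ ∏ i, q ^ n i := by
  rw [chainProd, norm_prod]
  refine Finset.prod_le_prod (fun i _ => norm_nonneg _) fun i _ => ?_
  have h1 := one_le_qnum hq0 hq1 (hn i)
  rw [norm_div, norm_pow, norm_real, norm_real, Real.norm_of_nonneg hq0.le,
    Real.norm_of_nonneg (by linarith)]
  exact div_le_self (by positivity) h1

/-- The common majorant of the factors of `F1term`, `F2term` and `F3term` depending on `t`. -/
noncomputable def qweight (q : ℝ) (d : ℕ) (σ : ℝ) (t : ℕ) : ℝ :=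
  q ^ ((σ - d - 2) * (t : ℝ)) / qnum q t ^ (σ - d - 1)

section TermBounds

variable {q : ℝ} {d : ℕ} {s : ℂ} {t m : ℕ}

theorem norm_qpow_cpow (hq0 : 0 < q) (n : ℕ) :
    ‖(q : ℂ) ^ ((s - (d : ℂ) - 2) * (n : ℂ))‖ = q ^ ((s.re - d - 2) * (n : ℝ)) := by
  rw [norm_cpow_eq_rpow_re_of_pos hq0]
  simp

theorem norm_qnum_cpow (hq0 : 0 < q) (hq1 : q < 1) {n : ℕ} (hn : 1 ≤ n) :
    ‖(qnum q n : ℂ) ^ (s - (d : ℂ) - 1)‖ = qnum q n ^ (s.re - d - 1) := by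
  rw [norm_cpow_eq_rpow_re_of_pos (by linarith [one_le_qnum hq0 hq1 hn])]
  simp

theorem norm_qnum (hq0 : 0 < q) (hq1 : q < 1) {n : ℕ} (hn : 1 ≤ n) :
    ‖(qnum q n : ℂ)‖ = qnum q n := by
  rw [norm_real, Real.norm_of_nonneg (by linarith [one_le_qnum hq0 hq1 hn])]

theorem term_factor_le (hq0 : 0 < q) (hq1 : q < 1) (hs : (d : ℝ) + 2 < s.re) (ht : 1 ≤ t)
    {a b c : ℕ} (ha : t ≤ a) (hb : t ≤ b) (hc : 1 ≤ c) {k l : ℕ} (hkl : l ≤ k) :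
    ‖(q : ℂ) ^ ((s - (d : ℂ) - 2) * (a : ℂ)) * (q : ℂ) ^ k /
      ((qnum q b : ℂ) ^ (s - (d : ℂ) - 1) * (qnum q c : ℂ))‖ ≤
      qweight q d s.re t * q ^ l := by
  have hb1 := one_le_qnum hq0 hq1 (ht.trans hb)
  have ht1 := one_le_qnum hq0 hq1 ht
  have hc1 := one_le_qnum hq0 hq1 hc
  have htb := qnum_mono hq0 hq1 hb
  have hpow : 0 < qnum q t ^ (s.re - d - 1) := Real.rpow_pos_of_pos (by linarith) _
  have hden : qnum q t ^ (s.re - d - 1) ≤ qnum q b ^ (s.re - d - 1) * qnum q c :=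
    (Real.rpow_le_rpow (by linarith) htb (by linarith)).trans
      (le_mul_of_one_le_right (Real.rpow_nonneg (by linarith) _) hc1)
  have hnum : q ^ ((s.re - d - 2) * (a : ℝ)) ≤ q ^ ((s.re - d - 2) * (t : ℝ)) :=
    Real.rpow_le_rpow_of_exponent_ge hq0 hq1.le
      (mul_le_mul_of_nonneg_left (Nat.cast_le.2 ha) (by linarith))
  have hkl' : q ^ k ≤ q ^ l := pow_le_pow_of_le_one hq0.le hq1.le hkl
  rw [norm_div, norm_mul, norm_mul, norm_qpow_cpow hq0, norm_qnum_cpow hq0 hq1 (ht.trans hb),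
    norm_qnum hq0 hq1 hc, norm_pow, norm_real, Real.norm_of_nonneg hq0.le, qweight,
    div_mul_eq_mul_div]
  gcongr

theorem norm_F1term_le (hq0 : 0 < q) (hq1 : q < 1) (hs : (d : ℝ) + 2 < s.re) (ht : 1 ≤ t)
    (htm : t < m) {n : Fin d → ℕ} (hn : ∀ i, 1 ≤ n i) :
    ‖F1term q d s (t, m, n)‖ ≤ qweight q d s.re t * (q ^ (m - t) * ∏ i, q ^ n i) := by
  rw [F1term, norm_mul, ← mul_assoc]
  have h := term_factor_le hq0 hq1 hs ht (le_refl t) (le_refl t)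
    (Nat.sub_pos_of_lt htm) (le_refl (m - t))
  exact mul_le_mul h (norm_chainProd_le hq0 hq1 hn) (norm_nonneg _) ((norm_nonneg _).trans h)

theorem norm_F2term_le (hq0 : 0 < q) (hq1 : q < 1) (hs : (d : ℝ) + 2 < s.re) (ht : 1 ≤ t)
    (htm : t < m) {n : Fin d → ℕ} (hn : ∀ i, 1 ≤ n i) :
    ‖F2term q d s (t, m, n)‖ ≤ qweight q d s.re t * (q ^ (m - t) * ∏ i, q ^ n i) := by
  rw [F2term, norm_mul, ← mul_assoc]
  have h := term_factor_le hq0 hq1 hs ht htm.le (le_refl t) (ht.trans htm.le) (Nat.sub_le m t)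
  exact mul_le_mul h (norm_chainProd_le hq0 hq1 hn) (norm_nonneg _) ((norm_nonneg _).trans h)

theorem norm_F3term_le (hq0 : 0 < q) (hq1 : q < 1) (hs : (d : ℝ) + 2 < s.re) (ht : 1 ≤ t)
    (htm : t < m) {n : Fin d → ℕ} (hn : ∀ i, 1 ≤ n i) :
    ‖F3term q d s (t, m, n)‖ ≤ qweight q d s.re t * (q ^ (m - t) * ∏ i, q ^ n i) := by
  rw [F3term, norm_mul, ← mul_assoc]
  have h := term_factor_le hq0 hq1 hs ht htm.le htm.le
    (Nat.sub_pos_of_lt htm) (le_refl (m - t))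
  exact mul_le_mul h (norm_chainProd_le hq0 hq1 hn) (norm_nonneg _) ((norm_nonneg _).trans h)

end TermBounds

theorem qweight_nonneg {q : ℝ} (hq0 : 0 < q) (hq1 : q < 1) (d : ℕ) (σ : ℝ) {t : ℕ}
    (ht : 1 ≤ t) : 0 ≤ qweight q d σ t :=
  div_nonneg (Real.rpow_nonneg hq0.le _)
    (Real.rpow_nonneg (zero_le_one.trans (one_le_qnum hq0 hq1 ht)) _)

theorem qweight_le {q : ℝ} (hq0 : 0 < q) (hq1 : q < 1) {d : ℕ} {σ : ℝ} (hσ : (d : ℝ) + 2 < σ)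
    {t : ℕ} (ht : 1 ≤ t) : qweight q d σ t ≤ (q ^ (σ - d - 2)) ^ t := by
  rw [← Real.rpow_mul_natCast hq0.le]
  exact div_le_self (Real.rpow_nonneg hq0.le _)
    (Real.one_le_rpow (one_le_qnum hq0 hq1 ht) (by linarith))

theorem summable_qweight_mul_log_pow {q : ℝ} (hq0 : 0 < q) (hq1 : q < 1) {d : ℕ} {σ : ℝ}
    (hσ : (d : ℝ) + 2 < σ) (D k : ℕ) :
    Summable fun t : {t : ℕ // D < t} => qweight q d σ t.1 * Real.log (2 * t.1) ^ k := by
  have hr0 : 0 ≤ q ^ (σ - d - 2) := Real.rpow_nonneg hq0.le _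
  have hr1 : q ^ (σ - d - 2) < 1 := Real.rpow_lt_one hq0.le hq1 (by linarith)
  have hsum := ((summable_pow_mul_geometric_of_norm_lt_one k
    (by rwa [Real.norm_of_nonneg hr0] : ‖q ^ (σ - d - 2)‖ < 1)).mul_left ((2 : ℝ) ^ k)).subtype
    {t | D < t}
  refine hsum.of_nonneg_of_le (fun t => ?_) fun t => ?_
  · exact mul_nonneg (qweight_nonneg hq0 hq1 d σ (Nat.one_le_of_lt t.2))
      (pow_nonneg (by exact_mod_cast Real.log_natCast_nonneg (2 * t.1)) k)
  · have h0 : 0 ≤ Real.log (2 * t.1) := by exact_mod_cast Real.log_natCast_nonneg (2 * t.1)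
    have hl : Real.log (2 * t.1) ≤ 2 * t.1 := Real.log_le_self (by positivity)
    calc qweight q d σ t.1 * Real.log (2 * t.1) ^ k
        ≤ (q ^ (σ - d - 2)) ^ t.1 * (2 * (t.1 : ℝ)) ^ k :=
          mul_le_mul (qweight_le hq0 hq1 hσ (Nat.one_le_of_lt t.2))
            (pow_le_pow_left₀ h0 hl k) (pow_nonneg h0 k) (pow_nonneg hr0 _)
      _ = 2 ^ k * ((t.1 : ℝ) ^ k * (q ^ (σ - d - 2)) ^ t.1) := by
          rw [mul_pow]; ring

theorem summable_pow_mul_prod_pow {q : ℝ} (hq0 : 0 < q) (hq1 : q < 1) (d : ℕ) :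
    Summable fun p : ℕ × (Fin d → ℕ) => q ^ p.1 * ∏ i, q ^ p.2 i := by
  have hg := summable_geometric_of_lt_one hq0.le hq1
  have hp : Summable fun n : Fin d → ℕ => ∏ i, q ^ n i :=
    summable_pi_prod hg fun n => pow_nonneg hq0.le n
  have hg0 : 0 ≤ fun n : ℕ => q ^ n := fun n => pow_nonneg hq0.le n
  have hp0 : 0 ≤ fun n : Fin d → ℕ => ∏ i, q ^ n i :=
    fun n => Finset.prod_nonneg fun i _ => pow_nonneg hq0.le (n i)
  have hgp := hg.mul_of_nonneg hp hg0 hp0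
  exact hgp

theorem norm_tsum_FIdx_le {q : ℝ} (hq0 : 0 < q) (hq1 : q < 1) {d : ℕ} {σ : ℝ}
    (hσ : (d : ℝ) + 2 < σ) (D : ℕ) {f : ℕ × ℕ × (Fin d → ℕ) → ℂ}
    (hf : ∀ t m : ℕ, ∀ n : Fin d → ℕ, 1 ≤ t → t < m → (∀ i, 1 ≤ n i) →
      ‖f (t, m, n)‖ ≤ qweight q d σ t * (q ^ (m - t) * ∏ i, q ^ n i)) :
    ‖∑' p : FIdx D d, f p.1‖ ≤ (∑' t : {t : ℕ // D < t}, qweight q d σ t.1) *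
      ∑' p : ℕ × (Fin d → ℕ), q ^ p.1 * ∏ i, q ^ p.2 i := by
  have ha : Summable fun t : {t : ℕ // D < t} => qweight q d σ t.1 := by
    simpa using summable_qweight_mul_log_pow hq0 hq1 hσ D 0
  have ha0 (t : {t : ℕ // D < t}) : 0 ≤ qweight q d σ t.1 :=
    qweight_nonneg hq0 hq1 d σ (Nat.one_le_of_lt t.2)
  have hb := summable_pow_mul_prod_pow hq0 hq1 d
  have hb0 (p : ℕ × (Fin d → ℕ)) : 0 ≤ q ^ p.1 * ∏ i, q ^ p.2 i := by positivity
  have hab := ha.mul_of_nonneg hb ha0 hb0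
  let e : FIdx D d → {t : ℕ // D < t} × (ℕ × (Fin d → ℕ)) :=
    fun p => (⟨p.1.1, p.2.1⟩, (p.1.2.1 - p.1.1, p.1.2.2))
  have he : Function.Injective e := by
    rintro ⟨⟨t, m, n⟩, hD, htm, hn⟩ ⟨⟨t', m', n'⟩, hD', htm', hn'⟩ h
    simp only [e, Prod.mk.injEq, Subtype.mk.injEq] at h htm htm'
    obtain ⟨rfl, hm, rfl⟩ := h
    obtain rfl : m = m' := by omega
    rfl
  rw [ha.tsum_mul_tsum hb hab]
  refine (tsum_of_norm_bounded (hab.comp_injective he).hasSum ?_).trans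
    (tsum_comp_le_tsum_of_inj hab (fun p => mul_nonneg (ha0 _) (hb0 _)) he)
  rintro ⟨⟨t, m, n⟩, hD, htm, -, hn⟩
  exact hf t m n (Nat.one_le_of_lt hD) htm
    fun i => (Nat.sub_pos_of_lt htm).trans_le (hn i).1

theorem tsum_qweight_le {q : ℝ} (hq0 : 0 < q) (hq1 : q < 1) {d : ℕ} {σ : ℝ}
    (hσ : (d : ℝ) + 2 < σ) (D k : ℕ) :
    ∑' t : {t : ℕ // D < t}, qweight q d σ t.1 ≤
      (Real.log 2 ^ k)⁻¹ *
        ∑' t : {t : ℕ // D < t}, qweight q d σ t.1 * Real.log (2 * t.1) ^ k := by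
  have hl : 0 < Real.log 2 := Real.log_pos one_lt_two
  rw [← tsum_mul_left]
  refine Summable.tsum_le_tsum (fun t => ?_)
    (by simpa using summable_qweight_mul_log_pow hq0 hq1 hσ D 0)
    ((summable_qweight_mul_log_pow hq0 hq1 hσ D k).mul_left _)
  have ht : 1 ≤ t.1 := Nat.one_le_of_lt t.2
  have ht' : (1 : ℝ) ≤ t.1 := by exact_mod_cast ht
  have hlog : Real.log 2 ^ k ≤ Real.log (2 * t.1) ^ k :=
    pow_le_pow_left₀ hl.le (Real.log_le_log two_pos (by linarith)) k
  rw [inv_mul_eq_div, le_div_iff₀ (pow_pos hl k)]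
  exact mul_le_mul_of_nonneg_left hlog (qweight_nonneg hq0 hq1 d σ ht)

/-- There is a constant `C > 0`, depending only on `q` and `d`, such that for every
`D ≥ 0`, every `s` with `σ = Re(s) > d + 2`, and each `i ∈ {1,2,3}`,
`|F_q^{(i)}(D;s;d)| ≤ C Σ_{t>D} q^{(σ−d−2)t} (log 2t)^{d+1} / [t]_q^{σ−d−1}`. -/
theorem F_uniform_bound (q : ℝ) (hq0 : 0 < q) (hq1 : q < 1) (d : ℕ) (hd : 1 ≤ d) :
    ∃ C > (0 : ℝ), ∀ D : ℕ, ∀ s : ℂ, (d : ℝ) + 2 < s.re →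
      ‖∑' p : FIdx D d, F1term q d s p.1‖ ≤
        C * ∑' t : {t : ℕ // D < t},
          q ^ ((s.re - d - 2) * (t.1 : ℝ)) * Real.log (2 * t.1) ^ (d + 1) /
            qnum q t.1 ^ (s.re - d - 1) ∧
      ‖∑' p : FIdx D d, F2term q d s p.1‖ ≤
        C * ∑' t : {t : ℕ // D < t},
          q ^ ((s.re - d - 2) * (t.1 : ℝ)) * Real.log (2 * t.1) ^ (d + 1) /
            qnum q t.1 ^ (s.re - d - 1) ∧
      ‖∑' p : FIdx D d, F3term q d s p.1‖ ≤
        C * ∑' t : {t : ℕ // D < t},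
          q ^ ((s.re - d - 2) * (t.1 : ℝ)) * Real.log (2 * t.1) ^ (d + 1) /
            qnum q t.1 ^ (s.re - d - 1) := by
  set K := ∑' p : ℕ × (Fin d → ℕ), q ^ p.1 * ∏ i, q ^ p.2 i
  have hK : 0 < K := (summable_pow_mul_prod_pow hq0 hq1 d).tsum_pos
    (fun p => by positivity) 0 (by simp)
  have hl : 0 < Real.log 2 := Real.log_pos one_lt_two
  refine ⟨(Real.log 2 ^ (d + 1))⁻¹ * K, by positivity, fun D s hs => ?_⟩
  have bound {f : ℕ × ℕ × (Fin d → ℕ) → ℂ}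
      (hf : ∀ t m : ℕ, ∀ n : Fin d → ℕ, 1 ≤ t → t < m → (∀ i, 1 ≤ n i) →
        ‖f (t, m, n)‖ ≤ qweight q d s.re t * (q ^ (m - t) * ∏ i, q ^ n i)) :
      ‖∑' p : FIdx D d, f p.1‖ ≤ (Real.log 2 ^ (d + 1))⁻¹ * K *
        ∑' t : {t : ℕ // D < t},
          q ^ ((s.re - d - 2) * (t.1 : ℝ)) * Real.log (2 * t.1) ^ (d + 1) /
            qnum q t.1 ^ (s.re - d - 1) := by
    refine (norm_tsum_FIdx_le hq0 hq1 hs D hf).trans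
      ((mul_le_mul_of_nonneg_right (tsum_qweight_le hq0 hq1 hs D (d + 1)) hK.le).trans_eq ?_)
    simp only [qweight, div_mul_eq_mul_div]
    ring
  exact ⟨bound fun t m n ht htm hn => norm_F1term_le hq0 hq1 hs ht htm hn,
    bound fun t m n ht htm hn => norm_F2term_le hq0 hq1 hs ht htm hn,
    bound fun t m n ht htm hn => norm_F3term_le hq0 hq1 hs ht htm hn⟩
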